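/- Let c > 0 and let p ≥ 2 be real. (i) For every β̃ > 0, setting δ̃ := β̃·(2+p)/(2p), every smooth ψ : ℝ² → ℝ with compact support contained in the half-plane H satisfies (∫ |ψ(x,y)/y^{δ̃}|^p dx dy)^{1/p} ≤ (p/(2√c)) · (∫ (c²(∂_x ψ)² + (∂_y ψ)²)^{p/(2+p)} y^{-β̃} dx dy)^{(2+p)/(2p)}. (ii) If moreover R > 0, β > −2/p, 0 < ε < 1 + pβ/2, and δ := β/2 + (1−ε)/p, then every smooth ψ with compact support contained in B_R⁺ := {(x,y) : x²+y² < R², y > 0} satisfies (∫ |ψ(x,y)/y^δ|^p dx dy)^{1/p} ≤ (p/(2√c)) · ((2/ε)·R^{1+ε})^{1/p} · (∫ (c²(∂_x ψ)² + (∂_y ψ)²) y^{-β} dx dy)^{1/2}. (Proposition 3.5, large-p case) -/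

import Mathlib

open MeasureTheory

noncomputable section

/-- The open upper half-plane `H = {(x,y) : y > 0}`. -/
def upperHalfPlane2 : Set (ℝ × ℝ) := {x | 0 < x.2}

/-- The open upper half-disc `B_R⁺ = {(x,y) : x² + y² < R², y > 0}`. -/
def halfDisc (R : ℝ) : Set (ℝ × ℝ) := {x | x.1 ^ 2 + x.2 ^ 2 < R ^ 2 ∧ 0 < x.2}

open Set in
/-- One-dimensional bound for a power of a compactly supported function by the integral, from
`-∞`, of the derivative of that power. -/
theorem abs_rpow_le_integral_Iic {f : ℝ → ℝ} (hf : ContDiff ℝ 1 f) (hs : HasCompactSupport f)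
    {a : ℝ} (ha : 1 ≤ a) (y : ℝ) :
    |f y| ^ a ≤ ∫ t in Iic y, a * |f t| ^ (a - 1) * |deriv f t| := by
  obtain rfl | ha := ha.eq_or_lt
  · simp only [Real.rpow_one, sub_self, Real.rpow_zero, one_mul]
    rw [← hs.integral_Iic_deriv_eq hf y]
    exact abs_integral_le_integral_abs
  have hg : ContDiff ℝ 1 (fun t => |f t| ^ a) := hf.norm_rpow ha
  have hgs : HasCompactSupport (fun t => |f t| ^ a) :=
    hs.comp_left (g := fun u : ℝ => |u| ^ a) (by simp [(zero_lt_one.trans ha).ne'])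
  have hd (t : ℝ) : |deriv (fun t => |f t| ^ a) t| = a * |f t| ^ (a - 1) * |deriv f t| := by
    have h1 := (hasDerivAt_abs_rpow (f t) ha).comp t
      (hf.differentiable one_ne_zero t).hasDerivAt
    have h2 : |f t| ^ (a - 2) * |f t| = |f t| ^ (a - 1) := by
      rcases eq_or_ne (f t) 0 with h0 | h0
      · simp [h0, Real.zero_rpow (sub_ne_zero.2 ha.ne')]
      · rw [← Real.rpow_add_one (abs_ne_zero.2 h0)]
        congr 1
        ring
    have h3 := h1.deriv
    simp only [Function.comp_def] at h3
    rw [h3, abs_mul, abs_mul, abs_mul, abs_of_pos (by linarith : 0 < a),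
      abs_of_nonneg (Real.rpow_nonneg (abs_nonneg (f t)) _), mul_assoc a, h2]
  rw [← hgs.integral_Iic_deriv_eq hg y]
  refine (le_abs_self _).trans (abs_integral_le_integral_abs.trans_eq ?_)
  simp only [hd]

/-- Loomis–Whitney type inequality in the plane. -/
theorem integral_sq_le_mul_integral {F P Q : ℝ × ℝ → ℝ} (hF : Continuous F)
    (hFs : HasCompactSupport F) (hF0 : ∀ x, 0 ≤ F x) (hP : Integrable P) (hQ : Integrable Q)
    (hFP : ∀ x y, F (x, y) ≤ ∫ s, P (s, y)) (hFQ : ∀ x y, F (x, y) ≤ ∫ t, Q (x, t)) :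
    ∫ z, F z ^ 2 ≤ (∫ z, P z) * ∫ z, Q z := by
  rw [Measure.volume_eq_prod] at hP hQ
  have hint : Integrable (fun z : ℝ × ℝ => (∫ t, Q (z.1, t)) * ∫ s, P (s, z.2)) := by
    rw [Measure.volume_eq_prod]
    exact hQ.integral_prod_left.mul_prod hP.integral_prod_right
  have hsq : Integrable fun z => F z ^ 2 := (hF.pow 2).integrable_of_hasCompactSupport
    (.intro hFs.isCompact fun x hx => by simp [image_eq_zero_of_notMem_tsupport hx])
  have hle (z : ℝ × ℝ) : F z ^ 2 ≤ (∫ t, Q (z.1, t)) * ∫ s, P (s, z.2) := by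
    obtain ⟨x, y⟩ := z
    rw [pow_two]
    exact mul_le_mul (hFQ x y) (hFP x y) (hF0 _) ((hF0 _).trans (hFQ x y))
  calc ∫ z, F z ^ 2 ≤ ∫ z : ℝ × ℝ, (∫ t, Q (z.1, t)) * ∫ s, P (s, z.2) :=
        integral_mono hsq hint hle
    _ = (∫ z, P z) * ∫ z, Q z := by
        rw [Measure.volume_eq_prod, integral_prod_mul (fun x => ∫ t, Q (x, t))
          (fun y => ∫ s, P (s, y)), ← integral_prod _ hQ, ← integral_prod_symm _ hP, mul_comm]

theorem isOpen_upperHalfPlane2 : IsOpen upperHalfPlane2 :=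
  isOpen_lt continuous_const continuous_snd

theorem continuous_mul_snd_rpow {K : Set (ℝ × ℝ)} (hK : IsCompact K) (hKH : K ⊆ upperHalfPlane2)
    {G : ℝ × ℝ → ℝ} (hG : Continuous G) (hG0 : ∀ x ∉ K, G x = 0) (r : ℝ) :
    Continuous fun x => G x * x.2 ^ r := by
  refine continuous_iff_continuousAt.2 fun x => ?_
  by_cases hx : x ∈ K
  · exact hG.continuousAt.mul
      (continuous_snd.continuousAt.rpow_const (Or.inl (hKH hx : 0 < x.2).ne'))
  · refine (continuousAt_const (y := (0 : ℝ))).congr ?_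
    filter_upwards [hK.isClosed.isOpen_compl.mem_nhds hx] with z hz
    simp [hG0 z hz]

theorem hasCompactSupport_mul_snd_rpow {K : Set (ℝ × ℝ)} (hK : IsCompact K)
    {G : ℝ × ℝ → ℝ} (hG0 : ∀ x ∉ K, G x = 0) (r : ℝ) :
    HasCompactSupport fun x : ℝ × ℝ => G x * x.2 ^ r :=
  .intro hK fun x hx => by simp [hG0 x hx]

theorem integrable_mul_snd_rpow {K : Set (ℝ × ℝ)} (hK : IsCompact K) (hKH : K ⊆ upperHalfPlane2)
    {G : ℝ × ℝ → ℝ} (hG : Continuous G) (hG0 : ∀ x ∉ K, G x = 0) (r : ℝ) :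
    Integrable fun x : ℝ × ℝ => G x * x.2 ^ r :=
  (continuous_mul_snd_rpow hK hKH hG hG0 r).integrable_of_hasCompactSupport
    (hasCompactSupport_mul_snd_rpow hK hG0 r)

theorem integrable_slice_fst {F : ℝ × ℝ → ℝ} (hF : Continuous F) (hs : HasCompactSupport F)
    (y : ℝ) : Integrable fun s => F (s, y) := by
  refine Continuous.integrable_of_hasCompactSupport (by fun_prop)
    (.intro (hs.isCompact.image continuous_fst) fun s h => ?_)
  by_contra h0
  exact h ⟨(s, y), subset_tsupport _ h0, rfl⟩

theorem integrable_slice_snd {F : ℝ × ℝ → ℝ} (hF : Continuous F) (hs : HasCompactSupport F)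
    (x : ℝ) : Integrable fun t => F (x, t) := by
  refine Continuous.integrable_of_hasCompactSupport (by fun_prop)
    (.intro (hs.isCompact.image continuous_snd) fun t h => ?_)
  by_contra h0
  exact h ⟨(x, t), subset_tsupport _ h0, rfl⟩

/-- The integrand `a |ψ|^{a-1} |∂_v ψ| y^{-k}`, the weighted directional derivative of `|ψ|^a`. -/
def weightedPowDeriv (ψ : ℝ × ℝ → ℝ) (a k : ℝ) (v : ℝ × ℝ) (x : ℝ × ℝ) : ℝ :=
  a * |ψ x| ^ (a - 1) * |fderiv ℝ ψ x v| * x.2 ^ (-k)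

section

variable {ψ : ℝ × ℝ → ℝ} (hψ : ContDiff ℝ 1 ψ) (hs : HasCompactSupport ψ)
  (hH : tsupport ψ ⊆ upperHalfPlane2)

include hψ in
theorem continuous_fderiv_apply_const (v : ℝ × ℝ) : Continuous fun x => fderiv ℝ ψ x v :=
  (hψ.continuous_fderiv one_ne_zero).clm_apply continuous_const

include hH in
theorem eq_zero_of_notMem_upperHalfPlane2 {x : ℝ × ℝ} (hx : x ∉ upperHalfPlane2) : ψ x = 0 :=
  image_eq_zero_of_notMem_tsupport fun h => hx (hH h)

include hψ hs hH in
theorem continuous_weightedPowDeriv {a : ℝ} (ha : 1 ≤ a) (k : ℝ) (v : ℝ × ℝ) :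
    Continuous (weightedPowDeriv ψ a k v) := by
  have h1 := continuous_fderiv_apply_const hψ v
  refine continuous_mul_snd_rpow hs.isCompact hH
    (((continuous_const.mul (hψ.continuous.abs.rpow_const fun x => Or.inr (by linarith)))).mul
      h1.abs) (fun x hx => ?_) _
  simp [fderiv_of_notMem_tsupport ℝ hx]

include hs in
theorem hasCompactSupport_weightedPowDeriv (a k : ℝ) (v : ℝ × ℝ) :
    HasCompactSupport (weightedPowDeriv ψ a k v) :=
  .intro hs.isCompact fun x hx => by
    simp [weightedPowDeriv, fderiv_of_notMem_tsupport ℝ hx]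

include hH in
theorem weightedPowDeriv_nonneg {a : ℝ} (ha : 1 ≤ a) (k : ℝ) (v x : ℝ × ℝ) :
    0 ≤ weightedPowDeriv ψ a k v x := by
  by_cases hx : x ∈ tsupport ψ
  · have : 0 < x.2 := hH hx
    unfold weightedPowDeriv
    positivity
  · simp [weightedPowDeriv, fderiv_of_notMem_tsupport ℝ hx]

include hψ hs hH in
theorem abs_rpow_mul_le_integral_fst {a : ℝ} (ha : 1 ≤ a) (k x y : ℝ) :
    |ψ (x, y)| ^ a * y ^ (-k) ≤ ∫ s, weightedPowDeriv ψ a k (1, 0) (s, y) := by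
  by_cases hy : 0 < y
  swap
  · rw [eq_zero_of_notMem_upperHalfPlane2 hH (x := (x, y)) hy, abs_zero,
      Real.zero_rpow (by linarith), zero_mul]
    exact integral_nonneg fun s => weightedPowDeriv_nonneg hH ha k _ _
  have hd (s : ℝ) : deriv (fun s => ψ (s, y)) s = fderiv ℝ ψ (s, y) (1, 0) :=
    ((hψ.differentiable one_ne_zero (s, y)).hasFDerivAt.comp_hasDerivAt s
      ((hasDerivAt_id s).prodMk (hasDerivAt_const s y))).deriv
  have h1 := abs_rpow_le_integral_Iic (f := fun s => ψ (s, y)) (hψ.comp (by fun_prop))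
    (.intro (hs.isCompact.image continuous_fst) fun s h => by
      by_contra h0
      exact h ⟨(s, y), subset_tsupport _ h0, rfl⟩) ha x
  simp only [hd] at h1
  calc |ψ (x, y)| ^ a * y ^ (-k)
      ≤ (∫ s in Set.Iic x, a * |ψ (s, y)| ^ (a - 1) * |fderiv ℝ ψ (s, y) (1, 0)|) * y ^ (-k) := by
        gcongr
    _ = ∫ s in Set.Iic x, weightedPowDeriv ψ a k (1, 0) (s, y) := (integral_mul_const _ _).symm
    _ ≤ ∫ s, weightedPowDeriv ψ a k (1, 0) (s, y) :=
        setIntegral_le_integral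
          (integrable_slice_fst (continuous_weightedPowDeriv hψ hs hH ha k _)
            (hasCompactSupport_weightedPowDeriv hs a k _) y)
          (.of_forall fun s => weightedPowDeriv_nonneg hH ha k _ _)

include hψ hs hH in
theorem abs_rpow_mul_le_integral_snd {a k : ℝ} (ha : 1 ≤ a) (hk : 0 ≤ k) (x y : ℝ) :
    |ψ (x, y)| ^ a * y ^ (-k) ≤ ∫ t, weightedPowDeriv ψ a k (0, 1) (x, t) := by
  by_cases hy : 0 < y
  swap
  · rw [eq_zero_of_notMem_upperHalfPlane2 hH (x := (x, y)) hy, abs_zero,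
      Real.zero_rpow (by linarith), zero_mul]
    exact integral_nonneg fun s => weightedPowDeriv_nonneg hH ha k _ _
  have hd (t : ℝ) : deriv (fun t => ψ (x, t)) t = fderiv ℝ ψ (x, t) (0, 1) :=
    ((hψ.differentiable one_ne_zero (x, t)).hasFDerivAt.comp_hasDerivAt t
      ((hasDerivAt_const t x).prodMk (hasDerivAt_id t))).deriv
  have h1 := abs_rpow_le_integral_Iic (f := fun t => ψ (x, t)) (hψ.comp (by fun_prop))
    (.intro (hs.isCompact.image continuous_snd) fun s h => by
      by_contra h0
      exact h ⟨(x, s), subset_tsupport _ h0, rfl⟩) ha y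
  simp only [hd] at h1
  have hint := integrable_slice_snd (continuous_weightedPowDeriv hψ hs hH ha k (0, 1))
    (hasCompactSupport_weightedPowDeriv hs a k _) x
  have hint0 := integrable_slice_snd (continuous_weightedPowDeriv hψ hs hH ha 0 (0, 1))
    (hasCompactSupport_weightedPowDeriv hs a 0 _) x
  simp only [weightedPowDeriv, neg_zero, Real.rpow_zero, mul_one] at hint0
  calc |ψ (x, y)| ^ a * y ^ (-k)
      ≤ (∫ t in Set.Iic y, a * |ψ (x, t)| ^ (a - 1) * |fderiv ℝ ψ (x, t) (0, 1)|) * y ^ (-k) := by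
        gcongr
    _ = ∫ t in Set.Iic y,
          a * |ψ (x, t)| ^ (a - 1) * |fderiv ℝ ψ (x, t) (0, 1)| * y ^ (-k) :=
        (integral_mul_const _ _).symm
    _ ≤ ∫ t in Set.Iic y, weightedPowDeriv ψ a k (0, 1) (x, t) := by
        refine setIntegral_mono_on (hint0.mul_const _).integrableOn hint.integrableOn
          measurableSet_Iic fun t ht => ?_
        by_cases hxt : (x, t) ∈ tsupport ψ
        · have ht0 : 0 < t := hH hxt
          exact mul_le_mul_of_nonneg_left
            (Real.rpow_le_rpow_of_nonpos ht0 ht (by linarith)) (by positivity)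
        · simp [weightedPowDeriv, fderiv_of_notMem_tsupport ℝ hxt]
    _ ≤ ∫ t, weightedPowDeriv ψ a k (0, 1) (x, t) :=
        setIntegral_le_integral hint
          (.of_forall fun s => weightedPowDeriv_nonneg hH ha k _ _)

end

/-- The squared anisotropic gradient `c² (∂_x ψ)² + (∂_y ψ)²`. -/
def anisoGradSq (c : ℝ) (ψ : ℝ × ℝ → ℝ) (x : ℝ × ℝ) : ℝ :=
  c ^ 2 * (fderiv ℝ ψ x (1, 0)) ^ 2 + (fderiv ℝ ψ x (0, 1)) ^ 2

theorem anisoGradSq_nonneg (c : ℝ) (ψ : ℝ × ℝ → ℝ) (x : ℝ × ℝ) : 0 ≤ anisoGradSq c ψ x := by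
  unfold anisoGradSq
  positivity

theorem anisoGradSq_eq_zero (c : ℝ) {ψ : ℝ × ℝ → ℝ} {x : ℝ × ℝ} (hx : x ∉ tsupport ψ) :
    anisoGradSq c ψ x = 0 := by
  simp [anisoGradSq, fderiv_of_notMem_tsupport ℝ hx]

theorem abs_fderiv_fst_le {c : ℝ} (hc : 0 < c) (ψ : ℝ × ℝ → ℝ) (x : ℝ × ℝ) :
    |fderiv ℝ ψ x (1, 0)| ≤ √(anisoGradSq c ψ x) / c := by
  rw [le_div_iff₀ hc]
  refine Real.le_sqrt_of_sq_le ?_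
  rw [mul_pow, sq_abs, anisoGradSq]
  nlinarith [sq_nonneg (fderiv ℝ ψ x (0, 1))]

theorem abs_fderiv_snd_le (c : ℝ) (ψ : ℝ × ℝ → ℝ) (x : ℝ × ℝ) :
    |fderiv ℝ ψ x (0, 1)| ≤ √(anisoGradSq c ψ x) := by
  refine Real.le_sqrt_of_sq_le ?_
  rw [sq_abs, anisoGradSq]
  nlinarith [sq_nonneg (c * fderiv ℝ ψ x (1, 0))]

/-- Conclusion of the Gagliardo–Nirenberg argument: absorbing the power of the left-hand side
that Hölder's inequality produces on the right. -/
theorem rpow_le_of_le_mul_sq {c p X Y J : ℝ} (hc : 0 < c) (hp : 2 ≤ p) (hX : 0 ≤ X)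
    (hY : 0 ≤ Y) (hJ : 0 ≤ J) (h1 : X ≤ (p / 2) ^ 2 / c * J ^ 2)
    (h2 : J ≤ X ^ ((p - 2) / (2 * p)) * Y ^ ((2 + p) / (2 * p))) :
    X ^ (1 / p) ≤ p / (2 * √c) * Y ^ ((2 + p) / (2 * p)) := by
  have hp0 : 0 < p := by linarith
  obtain rfl | hX := hX.eq_or_lt
  · rw [Real.zero_rpow (by positivity)]
    positivity
  have hsc : 0 < √c := Real.sqrt_pos.2 hc
  have h3 : X ^ (1 / 2 : ℝ) ≤ p / (2 * √c) * J := by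
    rw [← Real.sqrt_eq_rpow]
    refine Real.sqrt_le_iff.2 ⟨by positivity, h1.trans_eq ?_⟩
    rw [mul_pow, div_pow, div_pow, mul_pow, Real.sq_sqrt hc.le]
    field_simp
  have h4 : X ^ (1 / 2 : ℝ) = X ^ (1 / p) * X ^ ((p - 2) / (2 * p)) := by
    rw [← Real.rpow_add hX]
    congr 1
    field_simp
    ring
  have h5 : 0 < X ^ ((p - 2) / (2 * p)) := by positivity
  refine le_of_mul_le_mul_right ?_ h5
  calc X ^ (1 / p) * X ^ ((p - 2) / (2 * p)) ≤ p / (2 * √c) * J := h4 ▸ h3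
    _ ≤ p / (2 * √c) * (X ^ ((p - 2) / (2 * p)) * Y ^ ((2 + p) / (2 * p))) := by gcongr
    _ = _ := by ring

section

variable {ψ : ℝ × ℝ → ℝ} (hψ : ContDiff ℝ 1 ψ) (hs : HasCompactSupport ψ)
  (hH : tsupport ψ ⊆ upperHalfPlane2)

include hψ in
theorem continuous_anisoGradSq (c : ℝ) : Continuous (anisoGradSq c ψ) := by
  have h1 := continuous_fderiv_apply_const hψ (1, 0)
  have h2 := continuous_fderiv_apply_const hψ (0, 1)
  unfold anisoGradSq
  fun_prop

include hψ hs hH in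
theorem integral_abs_rpow_mul_le_sq {c p k : ℝ} (hc : 0 < c) (hp : 2 ≤ p) (hk : 0 ≤ k) :
    ∫ x, |ψ x| ^ p * x.2 ^ (-(2 * k)) ≤ (p / 2) ^ 2 / c *
      (∫ x, |ψ x| ^ (p / 2 - 1) * √(anisoGradSq c ψ x) * x.2 ^ (-k)) ^ 2 := by
  have ha : 1 ≤ p / 2 := by linarith
  have hz (x) (hx : x ∉ tsupport ψ) : ψ x = 0 := image_eq_zero_of_notMem_tsupport hx
  have hFz : ∀ x ∉ tsupport ψ, |ψ x| ^ (p / 2) = 0 := fun x hx => by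
    rw [hz x hx, abs_zero, Real.zero_rpow (by linarith)]
  have hFc : Continuous fun x => |ψ x| ^ (p / 2) :=
    hψ.continuous.abs.rpow_const fun x => Or.inr (by linarith)
  have hJint : Integrable fun x : ℝ × ℝ =>
      |ψ x| ^ (p / 2 - 1) * √(anisoGradSq c ψ x) * x.2 ^ (-k) :=
    integrable_mul_snd_rpow hs.isCompact hH
      ((hψ.continuous.abs.rpow_const fun x => Or.inr (by linarith)).mul
        (continuous_anisoGradSq hψ c).sqrt) (fun x hx => by simp [anisoGradSq_eq_zero c hx]) _
  have hw (v) : Integrable (weightedPowDeriv ψ (p / 2) k v) :=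
    (continuous_weightedPowDeriv hψ hs hH ha k v).integrable_of_hasCompactSupport
      (hasCompactSupport_weightedPowDeriv hs _ k v)
  have h1 := integral_sq_le_mul_integral
    (continuous_mul_snd_rpow hs.isCompact hH hFc hFz (-k))
    (hasCompactSupport_mul_snd_rpow hs.isCompact hFz (-k))
    (fun x => by
      by_cases hx : x ∈ tsupport ψ
      · have : 0 < x.2 := hH hx
        positivity
      · rw [hFz x hx, zero_mul])
    (hw (1, 0)) (hw (0, 1)) (abs_rpow_mul_le_integral_fst hψ hs hH ha k)
    (abs_rpow_mul_le_integral_snd hψ hs hH ha hk)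
  have hP : ∫ x, weightedPowDeriv ψ (p / 2) k (1, 0) x ≤
      p / 2 / c * ∫ x, |ψ x| ^ (p / 2 - 1) * √(anisoGradSq c ψ x) * x.2 ^ (-k) := by
    rw [← integral_const_mul]
    refine integral_mono (hw _) (hJint.const_mul _) fun x => ?_
    by_cases hx : x ∈ tsupport ψ
    · have : 0 < x.2 := hH hx
      calc weightedPowDeriv ψ (p / 2) k (1, 0) x
          ≤ p / 2 * |ψ x| ^ (p / 2 - 1) * (√(anisoGradSq c ψ x) / c) * x.2 ^ (-k) := by
            unfold weightedPowDeriv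
            gcongr
            exact abs_fderiv_fst_le hc ψ x
        _ = _ := by ring
    · simp [weightedPowDeriv, fderiv_of_notMem_tsupport ℝ hx, anisoGradSq_eq_zero c hx]
  have hQ : ∫ x, weightedPowDeriv ψ (p / 2) k (0, 1) x ≤
      p / 2 * ∫ x, |ψ x| ^ (p / 2 - 1) * √(anisoGradSq c ψ x) * x.2 ^ (-k) := by
    rw [← integral_const_mul]
    refine integral_mono (hw _) (hJint.const_mul _) fun x => ?_
    by_cases hx : x ∈ tsupport ψ
    · have : 0 < x.2 := hH hx
      calc weightedPowDeriv ψ (p / 2) k (0, 1) x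
          ≤ p / 2 * |ψ x| ^ (p / 2 - 1) * √(anisoGradSq c ψ x) * x.2 ^ (-k) := by
            unfold weightedPowDeriv
            gcongr
            exact abs_fderiv_snd_le c ψ x
        _ = _ := by ring
    · simp [weightedPowDeriv, fderiv_of_notMem_tsupport ℝ hx, anisoGradSq_eq_zero c hx]
  calc ∫ x, |ψ x| ^ p * x.2 ^ (-(2 * k)) = ∫ x, (|ψ x| ^ (p / 2) * x.2 ^ (-k)) ^ 2 := by
        congr 1 with x
        by_cases hx : x ∈ tsupport ψ
        · have : 0 < x.2 := hH hx
          rw [mul_pow, ← Real.rpow_mul_natCast (abs_nonneg _), ← Real.rpow_mul_natCast this.le]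
          push_cast
          ring_nf
        · rw [hFz x hx, hz x hx, abs_zero, Real.zero_rpow (by linarith)]
          simp
    _ ≤ _ := h1
    _ ≤ _ := mul_le_mul hP hQ (integral_nonneg fun x => weightedPowDeriv_nonneg hH ha k _ x)
        ((integral_nonneg fun x => weightedPowDeriv_nonneg hH ha k _ x).trans hP)
    _ = _ := by ring

include hψ hs hH in
theorem integral_mul_sqrt_anisoGradSq_le {p : ℝ} (c k : ℝ) (hp : 2 ≤ p) :
    ∫ x, |ψ x| ^ (p / 2 - 1) * √(anisoGradSq c ψ x) * x.2 ^ (-k) ≤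
      (∫ x, |ψ x| ^ p * x.2 ^ (-(2 * k))) ^ ((p - 2) / (2 * p)) *
      (∫ x, anisoGradSq c ψ x ^ (p / (2 + p)) * x.2 ^ (-(4 * k / (2 + p)))) ^
        ((2 + p) / (2 * p)) := by
  have hz (x) (hx : x ∉ tsupport ψ) : ψ x = 0 := image_eq_zero_of_notMem_tsupport hx
  obtain rfl | hp := hp.eq_or_lt
  · refine le_of_eq ?_
    norm_num
    congr 1 with x
    rw [Real.sqrt_eq_rpow]
  have hp2 : 0 < p - 2 := by linarith
  have hp0 : 0 < p := by linarith
  have hp3 : 0 < 2 + p := by linarith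
  have hconj : (2 * p / (p - 2)).HolderConjugate (2 * p / (2 + p)) := by
    refine Real.holderConjugate_iff.2 ⟨?_, ?_⟩
    · rw [lt_div_iff₀ hp2]
      linarith
    · field_simp
      ring
  have hGz : ∀ x ∉ tsupport ψ, √(anisoGradSq c ψ x) = 0 := fun x hx => by
    simp [anisoGradSq_eq_zero c hx]
  have hGc := (continuous_anisoGradSq hψ c).sqrt
  have hfz : ∀ x ∉ tsupport ψ, |ψ x| ^ (p / 2 - 1) = 0 := fun x hx => by
    rw [hz x hx, abs_zero, Real.zero_rpow (by linarith)]
  have hfc : Continuous fun x => |ψ x| ^ (p / 2 - 1) :=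
    hψ.continuous.abs.rpow_const fun x => Or.inr (by linarith)
  have h1 := integral_mul_le_Lp_mul_Lq_of_nonneg (μ := volume) hconj
    (f := fun x : ℝ × ℝ => |ψ x| ^ (p / 2 - 1) * x.2 ^ (-(k * (p - 2) / p)))
    (g := fun x : ℝ × ℝ => √(anisoGradSq c ψ x) * x.2 ^ (-(2 * k / p)))
    (.of_forall fun x => by
      by_cases hx : x ∈ tsupport ψ
      · have : 0 < x.2 := hH hx
        simp only [Pi.zero_apply]
        positivity
      · simp [hfz x hx])
    (.of_forall fun x => by
      by_cases hx : x ∈ tsupport ψ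
      · have : 0 < x.2 := hH hx
        simp only [Pi.zero_apply]
        positivity
      · simp [hGz x hx])
    ((continuous_mul_snd_rpow hs.isCompact hH hfc hfz _).memLp_of_hasCompactSupport
      (hasCompactSupport_mul_snd_rpow hs.isCompact hfz _))
    ((continuous_mul_snd_rpow hs.isCompact hH hGc hGz _).memLp_of_hasCompactSupport
      (hasCompactSupport_mul_snd_rpow hs.isCompact hGz _))
  rw [one_div_div, one_div_div] at h1
  convert! h1 using 1
  · congr 1 with x
    by_cases hx : x ∈ tsupport ψ
    · have : 0 < x.2 := hH hx
      rw [mul_mul_mul_comm, ← Real.rpow_add this]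
      congr 2
      field_simp
      ring
    · simp [hGz x hx]
  · congr 3 with x
    · by_cases hx : x ∈ tsupport ψ
      · have : 0 < x.2 := hH hx
        rw [Real.mul_rpow (by positivity) (by positivity), ← Real.rpow_mul (abs_nonneg _),
          ← Real.rpow_mul this.le]
        congr 2 <;> field_simp
      · rw [hfz x hx, hz x hx, abs_zero, Real.zero_rpow hp0.ne', zero_mul, zero_mul,
          Real.zero_rpow (by positivity)]
    · by_cases hx : x ∈ tsupport ψ
      · have : 0 < x.2 := hH hx
        rw [Real.mul_rpow (by positivity) (by positivity), Real.sqrt_eq_rpow,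
          ← Real.rpow_mul (anisoGradSq_nonneg c ψ x), ← Real.rpow_mul this.le]
        congr 2 <;> field_simp
        ring
      · rw [hGz x hx, anisoGradSq_eq_zero c hx, Real.zero_rpow (by positivity), zero_mul, zero_mul,
          Real.zero_rpow (by positivity)]

include hψ hs hH in
/-- Weighted Hardy–Sobolev inequality in the half-plane. -/
theorem integral_abs_div_rpow_le {c p β : ℝ} (hc : 0 < c) (hp : 2 ≤ p) (hβ : 0 < β) :
    (∫ x, |ψ x / x.2 ^ (β * (2 + p) / (2 * p))| ^ p) ^ (1 / p) ≤ p / (2 * √c) *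
      (∫ x, anisoGradSq c ψ x ^ (p / (2 + p)) * x.2 ^ (-β)) ^ ((2 + p) / (2 * p)) := by
  have hp0 : 0 < p := by linarith
  have hz (x) (hx : x ∉ tsupport ψ) : ψ x = 0 := image_eq_zero_of_notMem_tsupport hx
  have hX : ∫ x, |ψ x / x.2 ^ (β * (2 + p) / (2 * p))| ^ p =
      ∫ x, |ψ x| ^ p * x.2 ^ (-(2 * (β * (2 + p) / 4))) := by
    congr 1 with x
    by_cases hx : x ∈ tsupport ψ
    · have : 0 < x.2 := hH hx
      rw [abs_div, abs_of_nonneg (Real.rpow_nonneg this.le _),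
        Real.div_rpow (abs_nonneg _) (by positivity), ← Real.rpow_mul this.le,
        Real.rpow_neg this.le, div_eq_mul_inv]
      congr 3
      field_simp
      ring
    · rw [hz x hx, zero_div, abs_zero, Real.zero_rpow hp0.ne', zero_mul]
  have h2 := integral_mul_sqrt_anisoGradSq_le hψ hs hH c (β * (2 + p) / 4) hp
  rw [show 4 * (β * (2 + p) / 4) / (2 + p) = β by field_simp] at h2
  rw [hX]
  refine rpow_le_of_le_mul_sq hc hp ?_ ?_ ?_
    (integral_abs_rpow_mul_le_sq hψ hs hH hc hp (by positivity)) h2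
  · rw [← hX]
    exact integral_nonneg fun x => by positivity
  all_goals
    refine integral_nonneg fun x => ?_
    by_cases hx : x ∈ tsupport ψ
    · have : 0 < x.2 := hH hx
      have := anisoGradSq_nonneg c ψ x
      simp only [Pi.zero_apply]
      positivity
    · simp [anisoGradSq_eq_zero c hx, Real.zero_rpow (show p / (2 + p) ≠ 0 by positivity)]

end

theorem isOpen_halfDisc (R : ℝ) : IsOpen (halfDisc R) :=
  (isOpen_lt (f := fun x : ℝ × ℝ => x.1 ^ 2 + x.2 ^ 2) (by fun_prop) continuous_const).inter
    isOpen_upperHalfPlane2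

theorem halfDisc_subset_prod {R : ℝ} (hR : 0 < R) :
    halfDisc R ⊆ Set.Ioc (-R) R ×ˢ Set.Ioc 0 R := by
  rintro ⟨x, y⟩ ⟨h, hy⟩
  simp only at h hy
  have hx := abs_lt_of_sq_lt_sq' (show x ^ 2 < R ^ 2 by nlinarith) hR.le
  have hy' := abs_lt_of_sq_lt_sq' (show y ^ 2 < R ^ 2 by nlinarith) hR.le
  exact ⟨⟨hx.1, hx.2.le⟩, hy, hy'.2.le⟩

theorem integrableOn_prod_snd_rpow {R ε : ℝ} (hR : 0 < R) (hε : 0 < ε) :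
    IntegrableOn (fun x : ℝ × ℝ => x.2 ^ (ε - 1)) (Set.Ioc (-R) R ×ˢ Set.Ioc 0 R) := by
  rw [IntegrableOn, Measure.volume_eq_prod, ← Measure.prod_restrict]
  have h1 : IntegrableOn (fun y : ℝ => y ^ (ε - 1)) (Set.Ioc 0 R) :=
    (intervalIntegrable_iff_integrableOn_Ioc_of_le hR.le).1
      (intervalIntegral.intervalIntegrable_rpow' (by linarith))
  have h2 : IntegrableOn (fun _ : ℝ => (1 : ℝ)) (Set.Ioc (-R) R) := by simp
  simpa using Integrable.mul_prod h2 h1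

theorem setIntegral_halfDisc_snd_rpow_le {R ε : ℝ} (hR : 0 < R) (hε : 0 < ε) :
    ∫ x in halfDisc R, x.2 ^ (ε - 1) ≤ 2 / ε * R ^ (1 + ε) := by
  calc ∫ x in halfDisc R, x.2 ^ (ε - 1)
      ≤ ∫ x in Set.Ioc (-R) R ×ˢ Set.Ioc 0 R, x.2 ^ (ε - 1) := by
        refine setIntegral_mono_set (integrableOn_prod_snd_rpow hR hε) ?_
          (halfDisc_subset_prod hR).eventuallyLE
        filter_upwards [ae_restrict_mem (measurableSet_Ioc.prod measurableSet_Ioc)] with x hx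
        exact Real.rpow_nonneg hx.2.1.le _
    _ = (∫ _ in Set.Ioc (-R) R, (1 : ℝ)) * ∫ y in Set.Ioc 0 R, y ^ (ε - 1) := by
        rw [Measure.volume_eq_prod, ← setIntegral_prod_mul]
        simp
    _ = 2 / ε * R ^ (1 + ε) := by
        rw [← intervalIntegral.integral_of_le hR.le, integral_rpow (Or.inl (by linarith)),
          ← intervalIntegral.integral_of_le (by linarith), sub_add_cancel,
          Real.zero_rpow hε.ne', Real.rpow_add hR, Real.rpow_one]
        simp
        field_simp
        ring

theorem setIntegral_halfDisc_anisoGradSq_le {ψ : ℝ × ℝ → ℝ} (hψ : ContDiff ℝ 1 ψ)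
    (hs : HasCompactSupport ψ) (hH : tsupport ψ ⊆ upperHalfPlane2) {p R ε : ℝ} (c β : ℝ)
    (hp : 0 < p) (hR : 0 < R) (hε : 0 < ε) :
    ∫ x in halfDisc R, anisoGradSq c ψ x ^ (p / (2 + p)) *
        x.2 ^ (-((p * β + 2 * (1 - ε)) / (2 + p))) ≤
      (∫ x in halfDisc R, anisoGradSq c ψ x * x.2 ^ (-β)) ^ (p / (2 + p)) *
        (2 / ε * R ^ (1 + ε)) ^ (2 / (2 + p)) := by
  have hp3 : 0 < 2 + p := by linarith
  have hconj : ((2 + p) / p).HolderConjugate ((2 + p) / 2) := by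
    refine Real.holderConjugate_iff.2 ⟨?_, ?_⟩
    · rw [lt_div_iff₀ hp]
      linarith
    · field_simp
      ring
  have hmem : ∀ᵐ x : ℝ × ℝ ∂volume.restrict (halfDisc R), 0 < x.2 :=
    (ae_restrict_mem (isOpen_halfDisc R).measurableSet).mono fun x hx => hx.2
  have hGz : ∀ x ∉ tsupport ψ, anisoGradSq c ψ x ^ (p / (2 + p)) = 0 := fun x hx => by
    rw [anisoGradSq_eq_zero c hx, Real.zero_rpow (by positivity)]
  have hGc : Continuous fun x => anisoGradSq c ψ x ^ (p / (2 + p)) :=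
    (continuous_anisoGradSq hψ c).rpow_const fun x => Or.inr (by positivity)
  have hpow {x : ℝ × ℝ} (hx : 0 < x.2) :
      (x.2 ^ (2 * (ε - 1) / (2 + p))) ^ ((2 + p) / 2) = x.2 ^ (ε - 1) := by
    rw [← Real.rpow_mul hx.le]
    congr 1
    field_simp
  have hweight : MemLp (fun x : ℝ × ℝ => x.2 ^ (2 * (ε - 1) / (2 + p)))
      (ENNReal.ofReal ((2 + p) / 2)) (volume.restrict (halfDisc R)) := by
    refine (integrable_norm_rpow_iff (measurable_snd.pow_const _).aestronglyMeasurable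
      (by simpa using hp3) (by simp)).1 ?_
    refine ((integrableOn_prod_snd_rpow hR hε).mono_set (halfDisc_subset_prod hR)).congr ?_
    filter_upwards [hmem] with x hx
    rw [ENNReal.toReal_ofReal (by positivity), Real.norm_of_nonneg (by positivity), hpow hx]
  have h1 := integral_mul_le_Lp_mul_Lq_of_nonneg (μ := volume.restrict (halfDisc R)) hconj
    (f := fun x : ℝ × ℝ => anisoGradSq c ψ x ^ (p / (2 + p)) * x.2 ^ (-(β * p / (2 + p))))
    (g := fun x : ℝ × ℝ => x.2 ^ (2 * (ε - 1) / (2 + p)))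
    (hmem.mono fun x hx => by
      have := anisoGradSq_nonneg c ψ x
      simp only [Pi.zero_apply]
      positivity)
    (hmem.mono fun x hx => by
      simp only [Pi.zero_apply]
      positivity)
    ((continuous_mul_snd_rpow hs.isCompact hH hGc hGz _).memLp_of_hasCompactSupport
      (hasCompactSupport_mul_snd_rpow hs.isCompact hGz _))
    hweight
  rw [one_div_div, one_div_div] at h1
  have hprod : ∫ x in halfDisc R, anisoGradSq c ψ x ^ (p / (2 + p)) *
        x.2 ^ (-((p * β + 2 * (1 - ε)) / (2 + p))) =
      ∫ x in halfDisc R, anisoGradSq c ψ x ^ (p / (2 + p)) * x.2 ^ (-(β * p / (2 + p))) *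
        x.2 ^ (2 * (ε - 1) / (2 + p)) := by
    refine integral_congr_ae (hmem.mono fun x hx => ?_)
    simp only
    rw [mul_assoc, ← Real.rpow_add hx]
    congr 2
    field_simp
    ring
  have hgrad : ∫ x in halfDisc R, (anisoGradSq c ψ x ^ (p / (2 + p)) *
        x.2 ^ (-(β * p / (2 + p)))) ^ ((2 + p) / p) =
      ∫ x in halfDisc R, anisoGradSq c ψ x * x.2 ^ (-β) := by
    refine integral_congr_ae (hmem.mono fun x hx => ?_)
    have h0 := anisoGradSq_nonneg c ψ x
    simp only
    rw [Real.mul_rpow (by positivity) (by positivity), ← Real.rpow_mul h0, ← Real.rpow_mul hx.le,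
      show p / (2 + p) * ((2 + p) / p) = 1 by field_simp, Real.rpow_one]
    congr 2
    field_simp
  have hw : ∫ x in halfDisc R, (x.2 ^ (2 * (ε - 1) / (2 + p))) ^ ((2 + p) / 2) ≤
      2 / ε * R ^ (1 + ε) := by
    refine (integral_congr_ae (hmem.mono fun x hx => ?_)).trans_le
      (setIntegral_halfDisc_snd_rpow_le hR hε)
    exact hpow hx
  rw [hprod, ← hgrad]
  refine h1.trans (mul_le_mul_of_nonneg_left (Real.rpow_le_rpow ?_ hw (by positivity)) ?_)
  · exact integral_nonneg_of_ae (hmem.mono fun x hx => by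
      simp only [Pi.zero_apply]
      positivity)
  · refine Real.rpow_nonneg (integral_nonneg_of_ae (hmem.mono fun x hx => ?_)) _
    have := anisoGradSq_nonneg c ψ x
    simp only [Pi.zero_apply]
    positivity

theorem setIntegral_abs_div_rpow_eq {ψ : ℝ × ℝ → ℝ} {s : Set (ℝ × ℝ)} (hs : tsupport ψ ⊆ s)
    {p : ℝ} (hp : 0 < p) (r : ℝ) :
    ∫ x in s, |ψ x / x.2 ^ r| ^ p = ∫ x, |ψ x / x.2 ^ r| ^ p := by
  refine setIntegral_eq_integral_of_forall_compl_eq_zero fun x hx => ?_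
  rw [image_eq_zero_of_notMem_tsupport fun h => hx (hs h), zero_div, abs_zero,
    Real.zero_rpow hp.ne']

theorem setIntegral_anisoGradSq_rpow_eq {ψ : ℝ × ℝ → ℝ} {s : Set (ℝ × ℝ)} (hs : tsupport ψ ⊆ s)
    {q : ℝ} (hq : 0 < q) (c r : ℝ) :
    ∫ x in s, anisoGradSq c ψ x ^ q * x.2 ^ r = ∫ x, anisoGradSq c ψ x ^ q * x.2 ^ r := by
  refine setIntegral_eq_integral_of_forall_compl_eq_zero fun x hx => ?_
  rw [anisoGradSq_eq_zero c fun h => hx (hs h), Real.zero_rpow hq.ne', zero_mul]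

/-- Proposition 3.5 (large-p case). (i) For `β̃ > 0`, `δ̃ = β̃(2+p)/(2p)` and smooth `ψ`
compactly supported in the half-plane,
`(∫ |ψ/y^{δ̃}|^p)^{1/p} ≤ (p/(2√c)) ‖∇_c ψ‖_{2p/(2+p), β̃}`.
(ii) For `R > 0`, `β > -2/p`, `0 < ε < 1 + pβ/2`, `δ = β/2 + (1-ε)/p` and smooth `ψ`
compactly supported in `B_R⁺`,
`(∫ |ψ/y^δ|^p)^{1/p} ≤ (p/(2√c)) ((2/ε) R^{1+ε})^{1/p} ‖∇_c ψ‖_β`. -/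
theorem prop_3_5 (c p : ℝ) (hc : 0 < c) (hp : 2 ≤ p) :
    (∀ βt : ℝ, 0 < βt →
      ∀ ψ : ℝ × ℝ → ℝ, ContDiff ℝ (⊤ : ℕ∞) ψ → HasCompactSupport ψ →
        tsupport ψ ⊆ upperHalfPlane2 →
        (∫ x in upperHalfPlane2, |ψ x / x.2 ^ (βt * (2 + p) / (2 * p))| ^ p) ^ (1 / p)
          ≤ p / (2 * Real.sqrt c) *
            (∫ x in upperHalfPlane2,
              (c ^ 2 * (fderiv ℝ ψ x (1, 0)) ^ 2 + (fderiv ℝ ψ x (0, 1)) ^ 2)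
                ^ (p / (2 + p)) * x.2 ^ (-βt)) ^ ((2 + p) / (2 * p))) ∧
    (∀ R β ε : ℝ, 0 < R → -2 / p < β → 0 < ε → ε < 1 + p * β / 2 →
      ∀ ψ : ℝ × ℝ → ℝ, ContDiff ℝ (⊤ : ℕ∞) ψ → HasCompactSupport ψ →
        tsupport ψ ⊆ halfDisc R →
        (∫ x in halfDisc R, |ψ x / x.2 ^ (β / 2 + (1 - ε) / p)| ^ p) ^ (1 / p)
          ≤ p / (2 * Real.sqrt c) * ((2 / ε) * R ^ (1 + ε)) ^ (1 / p) *
            (∫ x in halfDisc R,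
              (c ^ 2 * (fderiv ℝ ψ x (1, 0)) ^ 2 + (fderiv ℝ ψ x (0, 1)) ^ 2)
                * x.2 ^ (-β)) ^ ((1 : ℝ) / 2)) := by
  have hp0 : 0 < p := by linarith
  have hq : 0 < p / (2 + p) := by positivity
  constructor
  · intro βt hβt ψ hψ hs hH
    have h1 := integral_abs_div_rpow_le (hψ.of_le (by simp)) hs hH hc hp hβt
    rwa [← setIntegral_abs_div_rpow_eq hH hp0, ← setIntegral_anisoGradSq_rpow_eq hH hq] at h1
  · intro R β ε hR hβ hε hεβ ψ hψ hs hD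
    have hψ1 : ContDiff ℝ 1 ψ := hψ.of_le (by simp)
    have hH : tsupport ψ ⊆ upperHalfPlane2 := fun x hx => (hD hx).2
    have hβt : 0 < (p * β + 2 * (1 - ε)) / (2 + p) := div_pos (by linarith) (by linarith)
    have h1 := integral_abs_div_rpow_le hψ1 hs hH hc hp hβt
    rw [← setIntegral_abs_div_rpow_eq hD hp0, ← setIntegral_anisoGradSq_rpow_eq hD hq,
      show (p * β + 2 * (1 - ε)) / (2 + p) * (2 + p) / (2 * p) = β / 2 + (1 - ε) / p by
        field_simp] at h1
    have h2 := setIntegral_halfDisc_anisoGradSq_le hψ1 hs hH c β hp0 hR hε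
    have hmem : ∀ᵐ x : ℝ × ℝ ∂volume.restrict (halfDisc R), 0 < x.2 :=
      (ae_restrict_mem (isOpen_halfDisc R).measurableSet).mono fun x hx => hx.2
    have hZ : 0 ≤ ∫ x in halfDisc R, anisoGradSq c ψ x * x.2 ^ (-β) :=
      integral_nonneg_of_ae (hmem.mono fun x hx =>
        mul_nonneg (anisoGradSq_nonneg c ψ x) (Real.rpow_nonneg hx.le _))
    have hY : 0 ≤ ∫ x in halfDisc R, anisoGradSq c ψ x ^ (p / (2 + p)) *
        x.2 ^ (-((p * β + 2 * (1 - ε)) / (2 + p))) :=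
      integral_nonneg_of_ae (hmem.mono fun x hx =>
        mul_nonneg (Real.rpow_nonneg (anisoGradSq_nonneg c ψ x) _) (Real.rpow_nonneg hx.le _))
    have hW : 0 ≤ 2 / ε * R ^ (1 + ε) := by positivity
    refine h1.trans ?_
    rw [mul_assoc]
    refine mul_le_mul_of_nonneg_left ?_ (by positivity)
    refine (Real.rpow_le_rpow hY h2 (by positivity)).trans_eq ?_
    rw [Real.mul_rpow (by positivity) (by positivity), ← Real.rpow_mul hZ, ← Real.rpow_mul hW,
      mul_comm]
    congr 2 <;> field_simp
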